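/- Let V be a real vector space, let ‖·‖ and N be two seminorms on V, let F ⊆ V be star-shaped about 0 (i.e., c·g ∈ F whenever g ∈ F and c ∈ [0,1]), and let t > 0. If |N(g)² − ‖g‖²| ≤ t²/2 for every g ∈ F with ‖g‖ ≤ t, then |N(g)² − ‖g‖²| ≤ (1/2)‖g‖² + (1/2)t² for every g ∈ F. -/

import Mathlib

/-- Rescaling argument coupling two seminorms on a star-shaped class: if
`|N(g)² - ‖g‖²| ≤ t²/2` for all `g ∈ F` with `‖g‖ ≤ t`, then
`|N(g)² - ‖g‖²| ≤ ½‖g‖² + ½t²` for all `g ∈ F`. -/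
theorem seminorm_coupling_rescale
    {V : Type*} [AddCommGroup V] [Module ℝ V]
    (p N : Seminorm ℝ V) (F : Set V)
    (hstar : ∀ g ∈ F, ∀ c : ℝ, c ∈ Set.Icc (0 : ℝ) 1 → c • g ∈ F)
    (t : ℝ) (ht : 0 < t)
    (hsmall : ∀ g ∈ F, p g ≤ t → |(N g) ^ 2 - (p g) ^ 2| ≤ t ^ 2 / 2) :
    ∀ g ∈ F, |(N g) ^ 2 - (p g) ^ 2| ≤ (1 / 2) * (p g) ^ 2 + (1 / 2) * t ^ 2 := by
  intro g hg
  by_cases h : p g ≤ t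
  · have := hsmall g hg h
    nlinarith [sq_nonneg (p g)]
  · push Not at h
    have hp : 0 < p g := ht.trans h
    have hc0 : 0 < t / p g := div_pos ht hp
    have hc1 : t / p g ≤ 1 := (div_le_one hp).2 h.le
    have hN : N ((t / p g) • g) = t / p g * N g := by
      rw [map_smul_eq_mul, Real.norm_of_nonneg hc0.le]
    have hP : p ((t / p g) • g) = t / p g * p g := by
      rw [map_smul_eq_mul, Real.norm_of_nonneg hc0.le]
    have hPt : t / p g * p g = t := div_mul_cancel₀ t hp.ne'
    have key := hsmall _ (hstar g hg _ ⟨hc0.le, hc1⟩) (by rw [hP, hPt])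
    rw [hN, hP, mul_pow, mul_pow, ← mul_sub, abs_mul, abs_of_pos (pow_pos hc0 2)] at key
    have h2 : t ^ 2 / 2 = (t / p g) ^ 2 * ((p g) ^ 2 / 2) := by
      field_simp
    rw [h2] at key
    have h3 := le_of_mul_le_mul_left key (pow_pos hc0 2)
    nlinarith [sq_nonneg t]
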